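/- Let n ≥ 1, let b be a nonnegative integer, set m = (b, 0) ∈ ℚ², and let d be an integer with d ≥ n + 1. Let λ ≠ μ be 2-multipartitions of n with κ^d_m(λ) = κ^d_m(μ). Then there exist 2-multipartitions λ₀ = λ, λ₁, …, λ_p = μ of n such that for every 0 ≤ i ≤ p−1, either (κ^d_{m+½}(λᵢ) ⊲ κ^d_{m+½}(λ_{i+1}) and κ^d_{m−½}(λ_{i+1}) ⊲ κ^d_{m−½}(λᵢ)) or (κ^d_{m+½}(λ_{i+1}) ⊲ κ^d_{m+½}(λᵢ) and κ^d_{m−½}(λᵢ) ⊲ κ^d_{m−½}(λ_{i+1})), where m ± ½ = (b ± ½, 0). -/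

import Mathlib

open scoped BigOperators

/-- `l` is (the list of parts of) a partition : a nonincreasing list of positive integers. -/
def IsPartitionList (l : List ℕ) : Prop := l.Pairwise (· ≥ ·) ∧ ∀ x ∈ l, 0 < x

/-- The β-sequence of a partition `λ` (written in increasing order) :
`(λ_h, …, λ_j − j + h, …, λ_1 − 1 + h)`, where `h` is the number of parts. -/
def betaRow (l : List ℕ) : List ℚ :=
  (List.range l.length).map (fun k => (l.getD (l.length - 1 - k) 0 : ℚ) + (k : ℚ))

/-- The shift `β(t)` of a finite sequence `β` by a rational `t ≥ 0` :
`β(t) = β` if `0 ≤ t < 1`, and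
`β(t) = (t−[t], t−[t]+1, …, t−1, β₁+t, …, β_k+t)` if `t ≥ 1`. -/
def shiftRow (β : List ℚ) (t : ℚ) : List ℚ :=
  if t < 1 then β
  else ((List.range (Int.toNat ⌊t⌋)).map (fun j => t - (⌊t⌋ : ℚ) + (j : ℚ))) ++
    β.map (· + t)

/-- The row `Bⁱ = βⁱ(d − hcⁱ)` of the shifted `m`-symbol of size `d`,
where `hcⁱ = h(λ^{i+1}) − mⁱ`. -/
def symbolRow (d : ℤ) (m : ℚ) (l : List ℕ) : List ℚ :=
  shiftRow (betaRow l) ((d : ℚ) - (l.length : ℚ) + m)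

/-- `κ^d_m(λ)` : all the entries of the shifted `m`-symbol of size `d` of the
`ℓ`-multipartition `λ`, written in nonincreasing order. -/
def kappa (ℓ : ℕ) (d : ℤ) (m : Fin ℓ → ℚ) (lam : Fin ℓ → List ℕ) : List ℚ :=
  List.insertionSort (fun a b : ℚ => b ≤ a)
    ((List.finRange ℓ).flatMap (fun i => symbolRow d (m i) (lam i)))

/-- Dominance (pre)order on finite rational sequences : every partial sum of `a`
is at most the corresponding partial sum of `b`. -/
def domLE (a b : List ℚ) : Prop :=
  ∀ i : ℕ, ∑ k ∈ Finset.range i, a.getD k 0 ≤ ∑ k ∈ Finset.range i, b.getD k 0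

/-- Strict dominance `a ⊲ b`. -/
def domLT (a b : List ℚ) : Prop := domLE a b ∧ a ≠ b

theorem list_sum_map_eq_sum_range (f : ℚ → ℚ) (L : List ℚ) :
    (L.map f).sum = ∑ i ∈ Finset.range L.length, f (L.getD i 0) := by
  induction L with
  | nil => simp
  | cons a L ih => simp [Finset.sum_range_succ', ih, add_comm]

theorem list_sum_eq_sum_range_getD (l : List ℕ) (N : ℕ) (h : l.length ≤ N) :
    l.sum = ∑ i ∈ Finset.range N, l.getD i 0 := by
  induction l generalizing N with
  | nil => simp
  | cons a l ih =>
    obtain ⟨N, rfl⟩ : ∃ M, N = M + 1 := ⟨N - 1, by simp at h; omega⟩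
    rw [Finset.sum_range_succ', List.sum_cons, ih N (by simpa using h)]
    simp [add_comm]

/-- Dominance of nonincreasing sequences of the same length follows from the comparison of all
the sums `∑ max (x - c) 0`. -/
theorem domLE_of_sum_max_le {L M : List ℚ} (hM : M.Pairwise (· ≥ ·))
    (hlen : L.length = M.length)
    (h : ∀ c : ℚ, (L.map (fun x => max (x - c) 0)).sum ≤ (M.map (fun x => max (x - c) 0)).sum) :
    domLE L M := by
  have key : ∀ k ≤ M.length,
      ∑ i ∈ Finset.range k, L.getD i 0 ≤ ∑ i ∈ Finset.range k, M.getD i 0 := by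
    intro k hk
    rcases Nat.eq_zero_or_pos k with rfl | hpos
    · simp
    have hanti : ∀ i j, i ≤ j → j < M.length → M.getD j 0 ≤ M.getD i 0 := by
      intro i j hij hj
      rcases hij.eq_or_lt with rfl | hij
      · exact le_rfl
      rw [List.getD_eq_getElem _ _ hj, List.getD_eq_getElem _ _ (hij.trans hj)]
      exact List.pairwise_iff_getElem.1 hM i j _ _ hij
    set c := M.getD (k - 1) 0 with hc
    have h1 := h c
    rw [list_sum_map_eq_sum_range, list_sum_map_eq_sum_range, hlen] at h1
    have h2 : ∑ i ∈ Finset.range M.length, max (M.getD i 0 - c) 0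
        = ∑ i ∈ Finset.range k, (M.getD i 0 - c) := by
      rw [← Finset.sum_subset (Finset.range_subset_range.2 hk)]
      · refine Finset.sum_congr rfl fun i hi => max_eq_left ?_
        have := hanti i (k - 1) (by simp at hi; omega) (by omega)
        linarith
      · intro i hi hik
        have := hanti (k - 1) i (by simp at hik; omega) (by simpa using hi)
        exact max_eq_right (by linarith)
    have h3 : ∑ i ∈ Finset.range k, (L.getD i 0 - c)
        ≤ ∑ i ∈ Finset.range M.length, max (L.getD i 0 - c) 0 :=
      (Finset.sum_le_sum fun i _ => le_max_left _ _).trans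
        (Finset.sum_le_sum_of_subset_of_nonneg (Finset.range_subset_range.2 hk)
          fun i _ _ => le_max_right _ _)
    rw [Finset.sum_sub_distrib] at h2 h3
    linarith
  intro k
  rcases le_total k M.length with hk | hk
  · exact key k hk
  · have hsub := Finset.range_subset_range.2 hk
    rw [← Finset.sum_subset hsub, ← Finset.sum_subset hsub]
    · exact key _ le_rfl
    · intro i _ hi
      exact List.getD_eq_default _ _ (by simpa using hi)
    · intro i _ hi
      exact List.getD_eq_default _ _ (by simpa [hlen] using hi)

theorem domLT_of_sum_max_le {L M : List ℚ} (hM : M.Pairwise (· ≥ ·))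
    (hlen : L.length = M.length)
    (h : ∀ c : ℚ, (L.map (fun x => max (x - c) 0)).sum ≤ (M.map (fun x => max (x - c) 0)).sum)
    (hlt : ∃ c : ℚ,
      (L.map (fun x => max (x - c) 0)).sum < (M.map (fun x => max (x - c) 0)).sum) :
    domLT L M := by
  refine ⟨domLE_of_sum_max_le hM hlen h, ?_⟩
  rintro rfl
  obtain ⟨c, hc⟩ := hlt
  exact hc.false

/-- The `k`-th smallest element of the β-set of size `N` of `l`. -/
def betaFun (N : ℕ) (l : List ℕ) (k : ℕ) : ℕ := l.getD (N - 1 - k) 0 + k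

/-- The β-set of size `N` of the partition `l`. -/
def betaSet (N : ℕ) (l : List ℕ) : Finset ℕ := (Finset.range N).image (betaFun N l)

theorem IsPartitionList.getD_le {l : List ℕ} (hl : IsPartitionList l) {i j : ℕ} (hij : i ≤ j) :
    l.getD j 0 ≤ l.getD i 0 := by
  rcases hij.eq_or_lt with rfl | hij
  · exact le_rfl
  rcases lt_or_ge j l.length with hj | hj
  · rw [List.getD_eq_getElem _ _ hj, List.getD_eq_getElem _ _ (hij.trans hj)]
    exact List.pairwise_iff_getElem.1 hl.1 i j _ _ hij
  · rw [List.getD_eq_default _ _ hj]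
    exact Nat.zero_le _

theorem betaFun_strictMono {l : List ℕ} (hl : IsPartitionList l) (N : ℕ) :
    StrictMono (betaFun N l) := by
  intro i j hij
  have := hl.getD_le (i := N - 1 - j) (j := N - 1 - i) (by omega)
  simp only [betaFun]
  omega

theorem sum_betaSet {M : Type*} [AddCommMonoid M] {l : List ℕ} (hl : IsPartitionList l) (N : ℕ)
    (f : ℕ → M) :
    ∑ x ∈ betaSet N l, f x = ∑ k ∈ Finset.range N, f (betaFun N l k) :=
  Finset.sum_image (betaFun_strictMono hl N).injective.injOn

theorem card_betaSet {l : List ℕ} (hl : IsPartitionList l) (N : ℕ) : (betaSet N l).card = N := by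
  rw [betaSet, Finset.card_image_of_injective _ (betaFun_strictMono hl N).injective,
    Finset.card_range]

theorem sum_id_betaSet {l : List ℕ} (hl : IsPartitionList l) {N : ℕ} (h : l.length ≤ N) :
    ∑ x ∈ betaSet N l, x = l.sum + ∑ k ∈ Finset.range N, k := by
  rw [sum_betaSet hl N (fun x => x), list_sum_eq_sum_range_getD l N h,
    ← Finset.sum_range_reflect (fun i => l.getD i 0)]
  simp only [betaFun, Finset.sum_add_distrib]

theorem IsPartitionList.length_le_sum {l : List ℕ} (hl : IsPartitionList l) :
    l.length ≤ l.sum := by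
  simpa using List.card_nsmul_le_sum l 1 fun x hx => hl.2 x hx

theorem IsPartitionList.ext_getD {l l' : List ℕ} (hl : IsPartitionList l)
    (hl' : IsPartitionList l') (h : ∀ i, l.getD i 0 = l'.getD i 0) : l = l' := by
  have hlt : ∀ {a : List ℕ}, IsPartitionList a → ∀ i, i < a.length ↔ 0 < a.getD i 0 := by
    intro a ha i
    constructor
    · intro hi
      rw [List.getD_eq_getElem _ _ hi]
      exact ha.2 _ (List.getElem_mem hi)
    · intro hi
      by_contra hc
      rw [List.getD_eq_default _ _ (not_lt.1 hc)] at hi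
      exact hi.false
  have hlen : l.length = l'.length := by
    apply eq_of_forall_lt_iff
    intro i
    rw [hlt hl, hlt hl', h]
  refine List.ext_getElem hlen fun i h1 h2 => ?_
  have := h i
  rwa [List.getD_eq_getElem _ _ h1, List.getD_eq_getElem _ _ h2] at this

theorem betaSet_injective {l l' : List ℕ} (hl : IsPartitionList l) (hl' : IsPartitionList l')
    {N : ℕ} (h : l.length ≤ N) (h' : l'.length ≤ N) (he : betaSet N l = betaSet N l') :
    l = l' := by
  have hrange : ∀ a : List ℕ,
      Set.range (fun k : Fin N => betaFun N a k) = (betaSet N a : Set ℕ) := by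
    intro a
    ext x
    simp only [Set.mem_range, betaSet, Finset.coe_image, Set.mem_image, Finset.mem_coe,
      Finset.mem_range]
    exact ⟨fun ⟨k, hk⟩ => ⟨k, k.2, hk⟩, fun ⟨k, hk, hx⟩ => ⟨⟨k, hk⟩, hx⟩⟩
  have hmono : ∀ {a : List ℕ}, IsPartitionList a → StrictMono (fun k : Fin N => betaFun N a k) :=
    fun ha _ _ hij => betaFun_strictMono ha N hij
  have hfun := (StrictMono.range_inj (hmono hl) (hmono hl')).1 (by rw [hrange, hrange, he])
  refine hl.ext_getD hl' fun i => ?_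
  rcases lt_or_ge i N with hi | hi
  · have := congrFun hfun ⟨N - 1 - i, by omega⟩
    simp only [betaFun] at this
    rw [show N - 1 - (N - 1 - i) = i by omega] at this
    omega
  · rw [List.getD_eq_default _ _ (h.trans hi), List.getD_eq_default _ _ (h'.trans hi)]

theorem getD_filter_pos {l : List ℕ} (hl : l.Pairwise (· ≥ ·)) (i : ℕ) :
    (l.filter (0 < ·)).getD i 0 = l.getD i 0 := by
  induction l generalizing i with
  | nil => simp
  | cons a l ih =>
    rw [List.pairwise_cons] at hl
    rcases Nat.eq_zero_or_pos a with rfl | ha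
    · have hz : ∀ x ∈ l, x = 0 := fun x hx => Nat.le_zero.1 (hl.1 x hx)
      have hf : (0 :: l).filter (0 < ·) = [] := by
        simp only [List.filter_eq_nil_iff, List.mem_cons]
        rintro x (rfl | hx)
        · simp
        · simp [hz x hx]
      rw [hf]
      cases i with
      | zero => simp
      | succ i =>
        rw [List.getD_cons_succ, ← ih hl.2, List.filter_eq_nil_iff.2 fun x hx => by simp [hz x hx]]
        simp
    · rw [List.filter_cons_of_pos (by simpa using ha)]
      cases i with
      | zero => simp
      | succ i => rw [List.getD_cons_succ, List.getD_cons_succ, ih hl.2]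

theorem exists_betaSet_eq (X : Finset ℕ) :
    ∃ l, IsPartitionList l ∧ l.length ≤ X.card ∧ betaSet X.card l = X := by
  set N := X.card with hN
  set e : ℕ → ℕ := Nat.nth (· ∈ X) with he
  have hcard : ∀ hfin : {x | x ∈ X}.Finite, hfin.toFinset.card = N := by
    intro hfin
    rw [hN]
    congr 1
    ext
    rw [Set.Finite.mem_toFinset]
    rfl
  have hmono : ∀ i j, i < j → j < N → e i < e j := fun i j hij hj =>
    Nat.nth_lt_nth' hij (fun hfin => by rw [hcard hfin]; exact hj)
  have hmem : ∀ i, i < N → e i ∈ X := fun i hi =>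
    Nat.nth_mem i fun hfin => by rw [hcard hfin]; exact hi
  have hge : ∀ i, i < N → i ≤ e i := by
    intro i
    induction i with
    | zero => simp
    | succ i ih => intro hi; have := hmono i (i + 1) (by omega) hi; have := ih (by omega); omega
  have hdiff : ∀ j, j < N → ∀ i, i ≤ j → e i - i ≤ e j - j := by
    intro j hj i hij
    induction j, hij using Nat.le_induction with
    | base => exact le_rfl
    | succ j hij ih =>
      have := ih (by omega)
      have := hmono j (j + 1) (by omega) hj
      omega
  set u : List ℕ := (List.range N).map (fun i => e (N - 1 - i) - (N - 1 - i)) with hu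
  have hupair : u.Pairwise (· ≥ ·) := by
    rw [List.pairwise_iff_getElem]
    intro i j hi hj hij
    simp only [hu, List.length_map, List.length_range] at hi hj
    simp only [hu, List.getElem_map, List.getElem_range]
    exact hdiff _ (by omega) _ (by omega)
  have hsub : betaSet N (u.filter (0 < ·)) ⊆ X := by
    intro x hx
    obtain ⟨k, hk, rfl⟩ := Finset.mem_image.1 hx
    have hk : k < N := by simpa using hk
    rw [betaFun, getD_filter_pos hupair, List.getD_eq_getElem _ _ (by simp [hu]; omega)]
    simp only [hu, List.getElem_map, List.getElem_range]
    rw [show N - 1 - (N - 1 - k) = k by omega, Nat.sub_add_cancel (hge k hk)]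
    exact hmem k hk
  have hpart : IsPartitionList (u.filter (0 < ·)) :=
    ⟨hupair.filter _, fun x hx => by simpa using (List.mem_filter.1 hx).2⟩
  refine ⟨_, hpart, ?_, Finset.eq_of_subset_of_card_le hsub ?_⟩
  · exact (List.length_filter_le _ _).trans (by simp [hu])
  · rw [card_betaSet hpart]

theorem sum_map_shiftRow (l : List ℕ) (T : ℕ) (e : ℚ) (h1 : 1 ≤ T) (he : 0 ≤ e) (he1 : e < 1)
    (f : ℚ → ℚ) :
    ((shiftRow (betaRow l) (T + e)).map f).sum
      = ∑ k ∈ Finset.range (T + l.length), f ((betaFun (T + l.length) l k : ℚ) + e) := by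
  have hfl : ⌊(T : ℚ) + e⌋ = (T : ℤ) := by
    rw [Int.floor_eq_iff]; push_cast; constructor <;> linarith
  have h1' : (1 : ℚ) ≤ T := by exact_mod_cast h1
  rw [shiftRow, if_neg (by linarith), hfl]
  rw [Finset.sum_range_add, List.map_append, List.sum_append]
  congr 1
  · rw [Int.toNat_natCast, bind_pure_comp, List.map_eq_map, List.map_map, List.map_map,
      ← List.sum_toFinset _ List.nodup_range, List.toFinset_range]
    refine Finset.sum_congr rfl fun k hk => ?_
    have hk := Finset.mem_range.1 hk
    rw [betaFun, List.getD_eq_default _ _ (by omega)]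
    simp [add_comm]
  · rw [betaRow, List.map_map, List.map_map,
      ← List.sum_toFinset _ List.nodup_range, List.toFinset_range]
    refine Finset.sum_congr rfl fun k hk => ?_
    rw [betaFun, show T + l.length - 1 - (T + k) = l.length - 1 - k by omega]
    simp only [Function.comp]
    congr 1
    push_cast
    ring

theorem sum_map_symbolRow {l : List ℕ} (hl : IsPartitionList l) {d b : ℕ} {e : ℚ}
    (hd : l.length + 1 ≤ d) (he : 0 ≤ e) (he1 : e < 1) (f : ℚ → ℚ) :
    ((symbolRow d (b + e) l).map f).sum = ∑ x ∈ betaSet (d + b) l, f (x + e) := by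
  obtain ⟨T, rfl⟩ : ∃ T, d = l.length + 1 + T := ⟨_, (Nat.add_sub_cancel' hd).symm⟩
  have := sum_map_shiftRow l (1 + T + b) e (by omega) he he1 f
  rw [show 1 + T + b + l.length = l.length + 1 + T + b by omega] at this
  rw [sum_betaSet hl, ← this, symbolRow]
  congr 3
  push_cast
  ring

theorem sum_map_symbolRow_sub_half {l : List ℕ} (hl : IsPartitionList l) {d b : ℕ}
    (hd : l.length + 2 ≤ d + b) (f : ℚ → ℚ) :
    ((symbolRow d (b - 1 / 2) l).map f).sum + f (-1 / 2)
      = ∑ x ∈ betaSet (d + b) l, f (x - 1 / 2) := by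
  obtain ⟨T, hT⟩ : ∃ T, d + b = l.length + 2 + T := ⟨_, (Nat.add_sub_cancel' hd).symm⟩
  have hT' : (d : ℚ) + b = l.length + 2 + T := by exact_mod_cast hT
  have := sum_map_shiftRow l (1 + T) (1 / 2) (by omega) (by norm_num) (by norm_num) f
  rw [sum_betaSet hl, symbolRow,
    show (((d : ℕ) : ℤ) : ℚ) - (l.length : ℚ) + ((b : ℚ) - 1 / 2) = ((1 + T : ℕ) : ℚ) + 1 / 2 by
      push_cast; linarith, this, hT, show l.length + 2 + T = (1 + T + l.length) + 1 by omega,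
    Finset.sum_range_succ']
  congr 1
  · refine Finset.sum_congr rfl fun k _ => ?_
    rw [betaFun, betaFun,
      show 1 + T + l.length + 1 - 1 - (k + 1) = 1 + T + l.length - 1 - k by omega]
    congr 1
    push_cast
    ring
  · rw [betaFun, List.getD_eq_default _ _ (by omega)]
    norm_num

theorem sum_map_symbolRow_sub_half_le {l : List ℕ} (hl : IsPartitionList l) {d b : ℕ}
    (hd : l.length + 1 ≤ d) {f : ℚ → ℚ} (hf : Monotone f) :
    ((symbolRow d (b - 1 / 2) l).map f).sum + f (-1 / 2)
      ≤ ∑ x ∈ betaSet (d + b) l, f (x - 1 / 2) := by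
  rcases Nat.lt_or_ge (l.length + 1) (d + b) with h | h
  · exact (sum_map_symbolRow_sub_half hl h f).le
  obtain ⟨rfl, rfl⟩ : d = l.length + 1 ∧ b = 0 := by omega
  rw [sum_betaSet hl, symbolRow, shiftRow, if_pos (by push_cast; norm_num), betaRow, List.map_map,
    ← List.sum_toFinset _ List.nodup_range, List.toFinset_range, add_zero,
    Finset.sum_range_succ']
  refine add_le_add (Finset.sum_le_sum fun k _ => ?_) ?_
  · rw [betaFun, show l.length + 1 - 1 - (k + 1) = l.length - 1 - k by omega]
    simp only [Function.comp]
    apply hf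
    push_cast
    linarith
  · rw [betaFun, List.getD_eq_default _ _ (by omega)]
    norm_num

theorem sum_map_kappa (d : ℤ) (m : Fin 2 → ℚ) (lam : Fin 2 → List ℕ) (f : ℚ → ℚ) :
    ((kappa 2 d m lam).map f).sum
      = ((symbolRow d (m 0) (lam 0)).map f).sum + ((symbolRow d (m 1) (lam 1)).map f).sum := by
  rw [kappa, ((List.perm_insertionSort _ _).map f).sum_eq]
  simp [List.finRange_succ]

theorem kappa_pairwise (d : ℤ) (m : Fin 2 → ℚ) (lam : Fin 2 → List ℕ) :
    (kappa 2 d m lam).Pairwise (· ≥ ·) :=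
  List.pairwise_insertionSort (fun a b : ℚ => b ≤ a) _

theorem sum_map_kappa_add {lam : Fin 2 → List ℕ} (hlam : ∀ i, IsPartitionList (lam i)) {d b : ℕ}
    (hd : ∀ i, (lam i).length + 1 ≤ d) {e : ℚ} (he : 0 ≤ e) (he1 : e < 1) (f : ℚ → ℚ) :
    ((kappa 2 d ![b + e, 0] lam).map f).sum
      = ∑ x ∈ betaSet (d + b) (lam 0), f (x + e) + ∑ y ∈ betaSet d (lam 1), f y := by
  have h0 := sum_map_symbolRow (hlam 0) (b := b) (hd 0) he he1 f
  have h1 := sum_map_symbolRow (hlam 1) (b := 0) (hd 1) le_rfl zero_lt_one f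
  simp only [Nat.cast_zero, add_zero] at h1
  rw [sum_map_kappa, ← h0, ← h1]
  rfl

theorem sum_map_kappa_sub {lam : Fin 2 → List ℕ} (hlam : ∀ i, IsPartitionList (lam i)) {d b : ℕ}
    (hd : ∀ i, (lam i).length + 1 ≤ d) (h : (lam 0).length + 2 ≤ d + b) (f : ℚ → ℚ) :
    ((kappa 2 d ![b - 1 / 2, 0] lam).map f).sum + f (-1 / 2)
      = ∑ x ∈ betaSet (d + b) (lam 0), f (x - 1 / 2) + ∑ y ∈ betaSet d (lam 1), f y := by
  have h1 := sum_map_symbolRow (hlam 1) (b := 0) (hd 1) le_rfl zero_lt_one f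
  simp only [Nat.cast_zero, add_zero] at h1
  rw [sum_map_kappa, ← sum_map_symbolRow_sub_half (hlam 0) h f, ← h1, add_right_comm]
  rfl

theorem sum_map_kappa_sub_le {lam : Fin 2 → List ℕ} (hlam : ∀ i, IsPartitionList (lam i))
    {d b : ℕ} (hd : ∀ i, (lam i).length + 1 ≤ d) {f : ℚ → ℚ} (hf : Monotone f) :
    ((kappa 2 d ![b - 1 / 2, 0] lam).map f).sum + f (-1 / 2)
      ≤ ∑ x ∈ betaSet (d + b) (lam 0), f (x - 1 / 2) + ∑ y ∈ betaSet d (lam 1), f y := by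
  have h1 := sum_map_symbolRow (hlam 1) (b := 0) (hd 1) le_rfl zero_lt_one f
  simp only [Nat.cast_zero, add_zero] at h1
  have h0 := sum_map_symbolRow_sub_half_le (hlam 0) (b := b) (hd 0) hf
  rw [sum_map_kappa, ← h1, add_right_comm]
  exact add_le_add_left h0 _

theorem length_kappa_add {lam : Fin 2 → List ℕ} (hlam : ∀ i, IsPartitionList (lam i)) {d b : ℕ}
    (hd : ∀ i, (lam i).length + 1 ≤ d) {e : ℚ} (he : 0 ≤ e) (he1 : e < 1) :
    (kappa 2 d ![b + e, 0] lam).length = d + b + d := by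
  have := sum_map_kappa_add hlam (b := b) hd he he1 (fun _ => 1)
  simp only [List.map_const', List.sum_replicate, Finset.sum_const, card_betaSet (hlam _),
    nsmul_eq_mul, mul_one] at this
  exact_mod_cast this

theorem length_kappa_sub {lam : Fin 2 → List ℕ} (hlam : ∀ i, IsPartitionList (lam i)) {d b : ℕ}
    (hd : ∀ i, (lam i).length + 1 ≤ d) :
    (kappa 2 d ![b - 1 / 2, 0] lam).length + 1 = d + b + d := by
  have h1 := sum_map_kappa_sub_le hlam (b := b) hd (f := fun _ => 1) monotone_const
  have h2 := sum_map_kappa_sub_le hlam (b := b) hd (f := fun _ => -1) monotone_const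
  simp only [List.map_const', List.sum_replicate, Finset.sum_const, card_betaSet (hlam _),
    nsmul_eq_mul, mul_one, mul_neg] at h1 h2
  have h3 : ((kappa 2 d ![(b : ℚ) - 1 / 2, 0] lam).length : ℚ) + 1 = d + b + d := by
    push_cast at h1 h2
    linarith
  exact_mod_cast h3

/-- `X'` is obtained from the finite set `X` by replacing `s` by `t`. -/
def IsSwap (X X' : Finset ℕ) (s t : ℕ) : Prop :=
  s ∈ X ∧ t ∉ X ∧ X' = insert t (X.erase s)

theorem IsSwap.sum_add {M : Type*} [AddCommMonoid M] {X X' : Finset ℕ} {s t : ℕ}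
    (h : IsSwap X X' s t) (f : ℕ → M) : ∑ x ∈ X', f x + f s = ∑ x ∈ X, f x + f t := by
  obtain ⟨hs, ht, rfl⟩ := h
  rw [Finset.sum_insert (fun hc => ht (Finset.mem_of_mem_erase hc)), add_assoc,
    Finset.sum_erase_add _ _ hs, add_comm]

theorem IsSwap.symm {X X' : Finset ℕ} {s t : ℕ} (h : IsSwap X X' s t) : IsSwap X' X t s := by
  obtain ⟨hs, ht, rfl⟩ := h
  have hst : s ≠ t := fun hc => ht (hc ▸ hs)
  refine ⟨Finset.mem_insert_self _ _, by simp [hst], ?_⟩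
  rw [Finset.erase_insert (fun hc => ht (Finset.mem_of_mem_erase hc)), Finset.insert_erase hs]

theorem IsSwap.card_eq {X X' : Finset ℕ} {s t : ℕ} (h : IsSwap X X' s t) :
    X'.card = X.card := by
  have := h.sum_add (fun _ => 1)
  simpa using this

/-- Strict comparability of two bipartitions at `b + 1/2`, and in the opposite direction at
`b - 1/2`. -/
def OppositeLT (d : ℤ) (b : ℕ) (x y : Fin 2 → List ℕ) : Prop :=
  domLT (kappa 2 d ![(b : ℚ) + 1/2, 0] x) (kappa 2 d ![(b : ℚ) + 1/2, 0] y) ∧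
    domLT (kappa 2 d ![(b : ℚ) - 1/2, 0] y) (kappa 2 d ![(b : ℚ) - 1/2, 0] x)

theorem monotone_max_sub (c : ℚ) : Monotone (fun x : ℚ => max (x - c) 0) :=
  fun _ _ h => max_le_max (by linarith) le_rfl

theorem betaSet_nil (N : ℕ) : betaSet N [] = Finset.range N := by
  ext x
  simp [betaSet, betaFun]

theorem oppositeLT_of_swap {lam mu : Fin 2 → List ℕ} (hlam : ∀ i, IsPartitionList (lam i))
    (hmu : ∀ i, IsPartitionList (mu i)) {n d b : ℕ} (hlamn : (lam 0).sum + (lam 1).sum = n)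
    (hmun : (mu 0).sum + (mu 1).sum = n) (hd : n + 1 ≤ d) {s t : ℕ} (hst : s < t)
    (h0 : IsSwap (betaSet (d + b) (lam 0)) (betaSet (d + b) (mu 0)) s t)
    (h1 : IsSwap (betaSet d (lam 1)) (betaSet d (mu 1)) t s) :
    OppositeLT d b lam mu := by
  have hlen : ∀ i, (lam i).length + 1 ≤ d := by
    have := (hlam 0).length_le_sum
    have := (hlam 1).length_le_sum
    intro i; fin_cases i <;> simp <;> omega
  have hlen' : ∀ i, (mu i).length + 1 ≤ d := by
    have := (hmu 0).length_le_sum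
    have := (hmu 1).length_le_sum
    intro i; fin_cases i <;> simp <;> omega
  have hst' : (s : ℚ) + 1 ≤ t := by exact_mod_cast hst
  constructor
  · have hdiff : ∀ f : ℚ → ℚ,
        ((kappa 2 d ![(b : ℚ) + 1 / 2, 0] mu).map f).sum + f (s + 1 / 2) + f t
          = ((kappa 2 d ![(b : ℚ) + 1 / 2, 0] lam).map f).sum + f (t + 1 / 2) + f s := by
      intro f
      rw [sum_map_kappa_add hlam hlen (by norm_num) (by norm_num),
        sum_map_kappa_add hmu hlen' (by norm_num) (by norm_num)]
      have e0 := h0.sum_add (fun x => f (x + 1 / 2))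
      have e1 := h1.sum_add (fun x => f x)
      linarith
    refine domLT_of_sum_max_le (kappa_pairwise _ _ _) ?_ (fun c => ?_) ⟨t, ?_⟩
    · rw [length_kappa_add hlam hlen (by norm_num) (by norm_num),
        length_kappa_add hmu hlen' (by norm_num) (by norm_num)]
    · have := hdiff (fun x => max (x - c) 0)
      have hconv : max ((s : ℚ) + 1 / 2 - c) 0 + max (t - c) 0
          ≤ max ((t : ℚ) + 1 / 2 - c) 0 + max (s - c) 0 := by
        grind
      linarith
    · have := hdiff (fun x => max (x - t) 0)
      have e1 : max ((s : ℚ) + 1 / 2 - t) 0 = 0 := max_eq_right (by linarith)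
      have e2 : max ((t : ℚ) + 1 / 2 - t) 0 = 1 / 2 := by rw [max_eq_left] <;> linarith
      have e3 : max ((s : ℚ) - t) 0 = 0 := max_eq_right (by linarith)
      simp only [e1, e2, e3, sub_self, max_self] at this
      linarith
  · have hlong : (lam 0).length + 2 ≤ d + b := by
      by_contra hc
      have hl0 := (hlam 0).length_le_sum
      have hl1 := (hlam 1).length_le_sum
      have := hlen 0
      have hnil : lam 1 = [] := List.eq_nil_of_length_eq_zero (by omega)
      have ht := h1.1
      have hs := h1.2.1
      rw [hnil, betaSet_nil, Finset.mem_range] at ht hs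
      omega
    have hdiff : ∀ f : ℚ → ℚ, Monotone f →
        ((kappa 2 d ![(b : ℚ) - 1 / 2, 0] mu).map f).sum + f (s - 1 / 2) + f t
          ≤ ((kappa 2 d ![(b : ℚ) - 1 / 2, 0] lam).map f).sum + f (t - 1 / 2) + f s := by
      intro f hf
      have e2 := sum_map_kappa_sub hlam hlen hlong f
      have e3 := sum_map_kappa_sub_le hmu (b := b) hlen' hf
      have e0 := h0.sum_add (fun x => f (x - 1 / 2))
      have e1 := h1.sum_add (fun x => f x)
      linarith
    refine domLT_of_sum_max_le (kappa_pairwise _ _ _) ?_ (fun c => ?_) ⟨t - 1 / 2, ?_⟩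
    · have e1 := length_kappa_sub hlam (b := b) hlen
      have e2 := length_kappa_sub hmu (b := b) hlen'
      omega
    · have := hdiff _ (monotone_max_sub c)
      have hconv : max ((t : ℚ) - 1 / 2 - c) 0 + max (s - c) 0
          ≤ max ((s : ℚ) - 1 / 2 - c) 0 + max (t - c) 0 := by
        grind
      linarith
    · have := hdiff _ (monotone_max_sub (t - 1 / 2))
      have e1 : max ((s : ℚ) - 1 / 2 - (t - 1 / 2)) 0 = 0 := max_eq_right (by linarith)
      have e2 : max ((t : ℚ) - (t - 1 / 2)) 0 = 1 / 2 := by rw [max_eq_left] <;> linarith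
      have e3 : max ((s : ℚ) - (t - 1 / 2)) 0 = 0 := max_eq_right (by linarith)
      simp only [e1, e2, e3, sub_self, max_self] at this
      linarith

/-- The two β-sets of `lam` have together the same multiset of elements as those of `mu`. -/
def SameEntries (d b : ℕ) (lam mu : Fin 2 → List ℕ) : Prop :=
  ∀ x, (if x ∈ betaSet (d + b) (lam 0) then 1 else 0) + (if x ∈ betaSet d (lam 1) then 1 else 0)
    = (if x ∈ betaSet (d + b) (mu 0) then 1 else 0) + (if x ∈ betaSet d (mu 1) then 1 else 0)

theorem sameEntries_of_kappa_eq {lam mu : Fin 2 → List ℕ} (hlam : ∀ i, IsPartitionList (lam i))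
    (hmu : ∀ i, IsPartitionList (mu i)) {d b : ℕ} (hd : ∀ i, (lam i).length + 1 ≤ d)
    (hd' : ∀ i, (mu i).length + 1 ≤ d)
    (h : kappa 2 d ![(b : ℚ), 0] lam = kappa 2 d ![(b : ℚ), 0] mu) :
    SameEntries d b lam mu := by
  intro x
  have e1 := sum_map_kappa_add hlam (b := b) hd le_rfl zero_lt_one
    (fun q => if q = x then 1 else 0)
  have e2 := sum_map_kappa_add hmu (b := b) hd' le_rfl zero_lt_one
    (fun q => if q = x then 1 else 0)
  rw [add_zero] at e1 e2
  rw [h, e2] at e1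
  simp only [add_zero, Nat.cast_inj, Finset.sum_ite_eq'] at e1
  have e3 := e1.symm
  split_ifs at e3 ⊢ <;> first | rfl | (exfalso; norm_num at e3)

theorem exists_chain {n d b : ℕ} (hd : n + 1 ≤ d) {mu : Fin 2 → List ℕ}
    (hmu : ∀ i, IsPartitionList (mu i)) (hmun : (mu 0).sum + (mu 1).sum = n) (k : ℕ)
    {lam : Fin 2 → List ℕ} (hlam : ∀ i, IsPartitionList (lam i))
    (hlamn : (lam 0).sum + (lam 1).sum = n) (hsame : SameEntries d b lam mu)
    (hk : (betaSet (d + b) (lam 0) \ betaSet (d + b) (mu 0)).card = k) :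
    ∃ (p : ℕ) (c : ℕ → (Fin 2 → List ℕ)), c 0 = lam ∧ c p = mu ∧
      (∀ i ≤ p, (∀ j, IsPartitionList (c i j)) ∧ (c i 0).sum + (c i 1).sum = n) ∧
      (∀ i < p, OppositeLT d b (c i) (c (i + 1)) ∨ OppositeLT d b (c (i + 1)) (c i)) := by
  induction k generalizing lam with
  | zero =>
    have hlen : (lam 0).length ≤ d + b ∧ (lam 1).length ≤ d ∧ (mu 0).length ≤ d + b ∧
        (mu 1).length ≤ d := by
      have := (hlam 0).length_le_sum
      have := (hlam 1).length_le_sum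
      have := (hmu 0).length_le_sum
      have := (hmu 1).length_le_sum
      omega
    have h0 : betaSet (d + b) (lam 0) = betaSet (d + b) (mu 0) :=
      Finset.eq_of_subset_of_card_le (Finset.sdiff_eq_empty_iff_subset.1 (Finset.card_eq_zero.1 hk))
        (by rw [card_betaSet (hlam 0), card_betaSet (hmu 0)])
    have h1 : betaSet d (lam 1) = betaSet d (mu 1) := by
      ext x
      have := hsame x
      rw [h0] at this
      split_ifs at this <;> simp_all
    have hl0 := betaSet_injective (hlam 0) (hmu 0) hlen.1 hlen.2.2.1 h0
    have hl1 := betaSet_injective (hlam 1) (hmu 1) hlen.2.1 hlen.2.2.2 h1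
    have : lam = mu := by
      funext i
      fin_cases i
      · exact hl0
      · exact hl1
    exact ⟨0, fun _ => lam, rfl, this, fun _ _ => ⟨hlam, hlamn⟩, fun i hi => absurd hi (by omega)⟩
  | succ k ih =>
    set X := betaSet (d + b) (lam 0) with hX
    set Y := betaSet d (lam 1) with hY
    set X₁ := betaSet (d + b) (mu 0) with hX₁
    set Y₁ := betaSet d (mu 1) with hY₁
    have hcX : X.card = d + b := card_betaSet (hlam 0) _
    have hcY : Y.card = d := card_betaSet (hlam 1) _
    have hcard : X.card = X₁.card := by rw [hcX, hX₁, card_betaSet (hmu 0)]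
    obtain ⟨s, hs⟩ := Finset.card_pos.1 (show 0 < (X \ X₁).card by omega)
    have hk' : (X₁ \ X).card = k + 1 := by rw [← Finset.card_sdiff_comm hcard, hk]
    obtain ⟨t, ht⟩ := Finset.card_pos.1 (show 0 < (X₁ \ X).card by omega)
    rw [Finset.mem_sdiff] at hs ht
    have hsY : s ∉ Y := by
      intro hc
      have := hsame s
      rw [if_pos hs.1, if_neg hs.2, if_pos hc] at this
      split_ifs at this <;> omega
    have htY : t ∈ Y := by
      by_contra hc
      have := hsame t
      rw [if_neg ht.2, if_pos ht.1, if_neg hc] at this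
      split_ifs at this <;> omega
    have hne : s ≠ t := fun hc => ht.2 (hc ▸ hs.1)
    have swX : IsSwap X (insert t (X.erase s)) s t := ⟨hs.1, ht.2, rfl⟩
    have swY : IsSwap Y (insert s (Y.erase t)) t s := ⟨htY, hsY, rfl⟩
    obtain ⟨l0, hl0, hlen0, hb0⟩ := exists_betaSet_eq (insert t (X.erase s))
    obtain ⟨l1, hl1, hlen1, hb1⟩ := exists_betaSet_eq (insert s (Y.erase t))
    rw [swX.card_eq, hcX] at hlen0 hb0
    rw [swY.card_eq, hcY] at hlen1 hb1
    rw [← hb0] at swX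
    rw [← hb1] at swY
    have hnun : l0.sum + l1.sum = n := by
      have e0 := swX.sum_add (fun x => x)
      have e1 := swY.sum_add (fun x => x)
      have := (hlam 0).length_le_sum
      have := (hlam 1).length_le_sum
      rw [sum_id_betaSet hl0 hlen0, hX, sum_id_betaSet (hlam 0) (by omega)] at e0
      rw [sum_id_betaSet hl1 hlen1, hY, sum_id_betaSet (hlam 1) (by omega)] at e1
      omega
    have hnu : ∀ i, IsPartitionList ((![l0, l1] : Fin 2 → List ℕ) i) := by
      intro i
      fin_cases i
      · exact hl0
      · exact hl1
    have hsame' : SameEntries d b ![l0, l1] mu := by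
      intro x
      rw [← hsame x]
      simp only [Matrix.cons_val_zero, Matrix.cons_val_one, hb0, hb1, ← hX, ← hY,
        Finset.mem_insert, Finset.mem_erase]
      rcases eq_or_ne x s with rfl | hxs
      · simp [hne, hs.1, hsY]
      rcases eq_or_ne x t with rfl | hxt
      · simp [Ne.symm hne, ht.2, htY]
      simp [hxs, hxt]
    have hk1 : (betaSet (d + b) ((![l0, l1] : Fin 2 → List ℕ) 0) \ betaSet (d + b) (mu 0)).card
        = k := by
      have : betaSet (d + b) ((![l0, l1] : Fin 2 → List ℕ) 0) \ betaSet (d + b) (mu 0)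
          = (X \ X₁).erase s := by
        rw [Matrix.cons_val_zero, hb0, ← hX₁, Finset.insert_sdiff_of_mem _ ht.1,
          Finset.erase_sdiff_comm]
      rw [this, Finset.card_erase_of_mem (Finset.mem_sdiff.2 hs), hk, Nat.add_sub_cancel]
    obtain ⟨p, c, hc0, hcp, hcpart, hstep⟩ := ih hnu hnun hsame' hk1
    refine ⟨p + 1, fun i => Nat.casesOn i lam c, rfl, hcp, ?_, ?_⟩
    · rintro (_ | i) hi
      · exact ⟨hlam, hlamn⟩
      · exact hcpart i (by omega)
    · rintro (_ | i) hi
      · change OppositeLT d b lam (c 0) ∨ OppositeLT d b (c 0) lam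
        rw [hc0]
        rcases lt_or_gt_of_ne hne with hlt | hlt
        · exact Or.inl (oppositeLT_of_swap hlam hnu hlamn hnun hd hlt swX swY)
        · exact Or.inr (oppositeLT_of_swap hnu hlam hnun hlamn hd hlt swX.symm swY.symm)
      · exact hstep i (by omega)

/-- If two distinct 2-multipartitions of `n` have the same `κ`-sequence at
`m = (b, 0)` (with `b ∈ ℤ≥0`), then they are connected by a chain of
2-multipartitions of `n` whose consecutive members are strictly comparable, in
opposite directions, for the dominance orders on `κ`-sequences at `m + ½` and
`m − ½`. -/
theorem statement17 (n : ℕ) (hn : 1 ≤ n) (b : ℕ) (d : ℤ) (hd : (n : ℤ) + 1 ≤ d)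
    (lam mu : Fin 2 → List ℕ)
    (hlam : ∀ i, IsPartitionList (lam i)) (hmu : ∀ i, IsPartitionList (mu i))
    (hlamn : ∑ i, (lam i).sum = n) (hmun : ∑ i, (mu i).sum = n)
    (hne : lam ≠ mu)
    (heq : kappa 2 d ![(b : ℚ), 0] lam = kappa 2 d ![(b : ℚ), 0] mu) :
    ∃ (p : ℕ) (c : ℕ → (Fin 2 → List ℕ)),
      c 0 = lam ∧ c p = mu ∧
      (∀ i ≤ p, (∀ j, IsPartitionList (c i j)) ∧ ∑ j, (c i j).sum = n) ∧
      (∀ i < p,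
        (domLT (kappa 2 d ![(b : ℚ) + 1/2, 0] (c i)) (kappa 2 d ![(b : ℚ) + 1/2, 0] (c (i + 1))) ∧
          domLT (kappa 2 d ![(b : ℚ) - 1/2, 0] (c (i + 1))) (kappa 2 d ![(b : ℚ) - 1/2, 0] (c i))) ∨
        (domLT (kappa 2 d ![(b : ℚ) + 1/2, 0] (c (i + 1))) (kappa 2 d ![(b : ℚ) + 1/2, 0] (c i)) ∧
          domLT (kappa 2 d ![(b : ℚ) - 1/2, 0] (c i)) (kappa 2 d ![(b : ℚ) - 1/2, 0] (c (i + 1))))) := by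
  rw [Fin.sum_univ_two] at hlamn hmun
  lift d to ℕ using by omega
  have hd : n + 1 ≤ d := by exact_mod_cast hd
  have hlen : ∀ {x : Fin 2 → List ℕ}, (∀ i, IsPartitionList (x i)) → (x 0).sum + (x 1).sum = n →
      ∀ i, (x i).length + 1 ≤ d := by
    intro x hx hxn i
    have := (hx 0).length_le_sum
    have := (hx 1).length_le_sum
    fin_cases i <;> simp <;> omega
  obtain ⟨p, c, h0, hp, hpart, hstep⟩ := exists_chain (b := b) hd hmu hmun _ hlam hlamn
    (sameEntries_of_kappa_eq hlam hmu (hlen hlam hlamn) (hlen hmu hmun) heq) rfl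
  exact ⟨p, c, h0, hp, fun i hi => ⟨(hpart i hi).1, by rw [Fin.sum_univ_two]; exact (hpart i hi).2⟩,
    hstep⟩
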